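/- Let K be a semifield, i ∈ I and c ∈ K. Suppose (i,a) ∼ (i',a') in ℐ×K^ν, where both first letters equal i: i_1 = i'_1 = i. Then (i,(c·a_1, a_2,…,a_ν)) ∼ (i',(c·a'_1, a'_2,…,a'_ν)). Consequently there is a well-defined bijection T_{i,c} : 𝒰_K → 𝒰_K sending the class of any (i,a) with i_1 = i to the class of (i,(c·a_1,a_2,…,a_ν)). -/

import Mathlib

open scoped BigOperators

namespace Lusztig

variable {I : Type*} [Fintype I] [DecidableEq I]

/-- A simply laced Cartan matrix: symmetric, positive definite, integer entries,
`2` on the diagonal and `0` or `-1` off the diagonal. -/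
structure IsSimplyLacedCartan (A : Matrix I I ℤ) : Prop where
  symm : ∀ i j, A i j = A j i
  posDef : ∀ x : I → ℤ, x ≠ 0 → 0 < ∑ i, ∑ j, x i * A i j * x j
  diag : ∀ i, A i i = 2
  offDiag : ∀ i j, i ≠ j → A i j = 0 ∨ A i j = -1

/-- The simple reflection `s_i` acting on `ℤ[I] = I → ℤ`, `s_i(j') = j' - a_{ij} i'`. -/
def sE (A : Matrix I I ℤ) (i : I) : Function.End (I → ℤ) :=
  fun x => x - (∑ j, A i j * x j) • Pi.single i 1

/-- The length of `w`: the least `n` such that `w` is a product of `n` simple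
reflections (`∞` convention: `sInf ∅ = 0`). -/
noncomputable def len (A : Matrix I I ℤ) (w : Function.End (I → ℤ)) : ℕ :=
  sInf {n | ∃ l : List I, l.length = n ∧ (l.map (sE A)).prod = w}

/-- `w₀` is the longest element of `W = ⟨s_i⟩` and `ν = |w₀|`. -/
structure IsLongest (A : Matrix I I ℤ) (w₀ : Function.End (I → ℤ)) (ν : ℕ) : Prop where
  mem : ∃ l : List I, (l.map (sE A)).prod = w₀
  len_eq : len A w₀ = ν
  longest : ∀ w : Function.End (I → ℤ),
    (∃ l : List I, (l.map (sE A)).prod = w) → len A w ≤ ν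

/-- `ℐ`: the set of sequences `(i_1, …, i_ν)` with `s_{i_1} ⋯ s_{i_ν} = w₀`. -/
def RedWord (A : Matrix I I ℤ) (w₀ : Function.End (I → ℤ)) (ν : ℕ) :
    Set (Fin ν → I) :=
  {f | ((List.ofFn f).map (sE A)).prod = w₀}

/-- The coefficient `r_{h,k}` defined by
`s_{i_1} ⋯ s_{i_{k-1}} (i_k') = Σ_h r_{h,k} h'` (here `k` is `0`-indexed). -/
def rCoef (A : Matrix I I ℤ) {ν : ℕ} (f : Fin ν → I) (h : I) (k : Fin ν) : ℤ :=
  ((List.ofFn fun m : Fin (k : ℕ) => sE A (f (Fin.castLE k.2.le m))).prod :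
    Function.End (I → ℤ)) (Pi.single (f k) 1) h

/-- `‖i,a‖_h = Π_k a_k^{r_{h,k}}`. -/
def normAt (A : Matrix I I ℤ) {ν : ℕ} {K : Type*} [CommGroup K]
    (f : Fin ν → I) (a : Fin ν → K) (h : I) : K :=
  ∏ k : Fin ν, a k ^ rCoef A f h k

section Semifield

variable {K : Type*} [CommGroup K] [AddCommSemigroup K]

/-- Adjacency of two pairs in `ℐ × K^ν`, for a semifield `K` (written
multiplicatively, with addition `+`). -/
def Adjacent (A : Matrix I I ℤ) (w₀ : Function.End (I → ℤ)) (ν : ℕ)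
    (p q : (Fin ν → I) × (Fin ν → K)) : Prop :=
  p.1 ∈ RedWord A w₀ ν ∧ q.1 ∈ RedWord A w₀ ν ∧
  ((∃ (l : ℕ) (h0 : l < ν) (h1 : l + 1 < ν) (h2 : l + 2 < ν),
      A (p.1 ⟨l, h0⟩) (p.1 ⟨l + 1, h1⟩) = -1 ∧
      p.1 ⟨l + 2, h2⟩ = p.1 ⟨l, h0⟩ ∧
      q.1 ⟨l, h0⟩ = p.1 ⟨l + 1, h1⟩ ∧ q.1 ⟨l + 1, h1⟩ = p.1 ⟨l, h0⟩ ∧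
      q.1 ⟨l + 2, h2⟩ = p.1 ⟨l + 1, h1⟩ ∧
      (∀ k : Fin ν, (k : ℕ) ≠ l → (k : ℕ) ≠ l + 1 → (k : ℕ) ≠ l + 2 →
        q.1 k = p.1 k ∧ q.2 k = p.2 k) ∧
      q.2 ⟨l, h0⟩ =
        p.2 ⟨l + 1, h1⟩ * p.2 ⟨l + 2, h2⟩ * (p.2 ⟨l, h0⟩ + p.2 ⟨l + 2, h2⟩)⁻¹ ∧
      q.2 ⟨l + 1, h1⟩ = p.2 ⟨l, h0⟩ + p.2 ⟨l + 2, h2⟩ ∧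
      q.2 ⟨l + 2, h2⟩ =
        p.2 ⟨l, h0⟩ * p.2 ⟨l + 1, h1⟩ * (p.2 ⟨l, h0⟩ + p.2 ⟨l + 2, h2⟩)⁻¹) ∨
   (∃ (l : ℕ) (h0 : l < ν) (h1 : l + 1 < ν),
      A (p.1 ⟨l, h0⟩) (p.1 ⟨l + 1, h1⟩) = 0 ∧
      q.1 ⟨l, h0⟩ = p.1 ⟨l + 1, h1⟩ ∧ q.1 ⟨l + 1, h1⟩ = p.1 ⟨l, h0⟩ ∧
      (∀ k : Fin ν, (k : ℕ) ≠ l → (k : ℕ) ≠ l + 1 →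
        q.1 k = p.1 k ∧ q.2 k = p.2 k) ∧
      q.2 ⟨l, h0⟩ = p.2 ⟨l + 1, h1⟩ ∧ q.2 ⟨l + 1, h1⟩ = p.2 ⟨l, h0⟩))

end Semifield

/-- Adjacency of two pairs in `ℐ × ℤ^ν` for the tropical semifield `ℤ`
(sum = `min`, product = `+`). -/
def TAdjacent (A : Matrix I I ℤ) (w₀ : Function.End (I → ℤ)) (ν : ℕ)
    (p q : (Fin ν → I) × (Fin ν → ℤ)) : Prop :=
  p.1 ∈ RedWord A w₀ ν ∧ q.1 ∈ RedWord A w₀ ν ∧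
  ((∃ (l : ℕ) (h0 : l < ν) (h1 : l + 1 < ν) (h2 : l + 2 < ν),
      A (p.1 ⟨l, h0⟩) (p.1 ⟨l + 1, h1⟩) = -1 ∧
      p.1 ⟨l + 2, h2⟩ = p.1 ⟨l, h0⟩ ∧
      q.1 ⟨l, h0⟩ = p.1 ⟨l + 1, h1⟩ ∧ q.1 ⟨l + 1, h1⟩ = p.1 ⟨l, h0⟩ ∧
      q.1 ⟨l + 2, h2⟩ = p.1 ⟨l + 1, h1⟩ ∧
      (∀ k : Fin ν, (k : ℕ) ≠ l → (k : ℕ) ≠ l + 1 → (k : ℕ) ≠ l + 2 →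
        q.1 k = p.1 k ∧ q.2 k = p.2 k) ∧
      q.2 ⟨l, h0⟩ =
        p.2 ⟨l + 1, h1⟩ + p.2 ⟨l + 2, h2⟩ - min (p.2 ⟨l, h0⟩) (p.2 ⟨l + 2, h2⟩) ∧
      q.2 ⟨l + 1, h1⟩ = min (p.2 ⟨l, h0⟩) (p.2 ⟨l + 2, h2⟩) ∧
      q.2 ⟨l + 2, h2⟩ =
        p.2 ⟨l, h0⟩ + p.2 ⟨l + 1, h1⟩ - min (p.2 ⟨l, h0⟩) (p.2 ⟨l + 2, h2⟩)) ∨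
   (∃ (l : ℕ) (h0 : l < ν) (h1 : l + 1 < ν),
      A (p.1 ⟨l, h0⟩) (p.1 ⟨l + 1, h1⟩) = 0 ∧
      q.1 ⟨l, h0⟩ = p.1 ⟨l + 1, h1⟩ ∧ q.1 ⟨l + 1, h1⟩ = p.1 ⟨l, h0⟩ ∧
      (∀ k : Fin ν, (k : ℕ) ≠ l → (k : ℕ) ≠ l + 1 →
        q.1 k = p.1 k ∧ q.2 k = p.2 k) ∧
      q.2 ⟨l, h0⟩ = p.2 ⟨l + 1, h1⟩ ∧ q.2 ⟨l + 1, h1⟩ = p.2 ⟨l, h0⟩))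

section Semifield

variable {K : Type*} [CommGroup K] [AddCommSemigroup K]

/-- Adjoining a zero to a semifield without zero yields a semifield in Mathlib's sense. -/
abbrev semifieldWithZero (hdist : ∀ a b c : K, a * (b + c) = a * b + a * c) :
    Semifield (WithZero K) :=
  letI : Distrib K :=
    { left_distrib := hdist
      right_distrib := fun a b c => by rw [mul_comm, hdist, mul_comm c, mul_comm c] }
  { (inferInstance : AddCommMonoid (WithZero K)), (inferInstance : CommGroupWithZero (WithZero K)),
    (inferInstance : Distrib (WithZero K)) with
    nnqsmul := _
    nnqsmul_def := fun _ _ => rfl }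

/-- Closed forms for one of the two ways around the Weyl group of type `A₃`. -/
lemma rank_three_closed_forms {F : Type*} [Semifield F]
    (hadd : ∀ x y : F, x ≠ 0 → y ≠ 0 → x + y ≠ 0) {a b c d e f s p q r y u v t R R' U : F}
    (ha : a ≠ 0) (hb : b ≠ 0) (hc : c ≠ 0) (hd : d ≠ 0) (he : e ≠ 0) (hf : f ≠ 0)
    (hR : R = a * (c + f) + d * f) (hR' : R' = a * (b + e) + d * e)
    (hU : U = a * b * c + a * b * f + a * e * c + a * e * f + d * e * f)
    (hs : s = c + f) (hp : p = d * f * s⁻¹) (hq : q = c * d * s⁻¹) (hr : r = a + p)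
    (hy : y = a * b * r⁻¹) (hu : u = y + e) (hv : v = q * e * u⁻¹) (ht : t = r + v) :
    b * p * r⁻¹ = b * d * f * R⁻¹ ∧ s * v * t⁻¹ = c * d * e * R'⁻¹ ∧ t = R * R' * U⁻¹ ∧
      r * s * t⁻¹ = U * R'⁻¹ ∧ u = U * R⁻¹ ∧ y * q * u⁻¹ = a * b * c * d * U⁻¹ := by
  have hs0 : s ≠ 0 := hs ▸ hadd _ _ hc hf
  have hR0 : R ≠ 0 :=
    hR ▸ hadd _ _ (mul_ne_zero ha (hadd _ _ hc hf)) (mul_ne_zero hd hf)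
  have hR0' : R' ≠ 0 :=
    hR' ▸ hadd _ _ (mul_ne_zero ha (hadd _ _ hb he)) (mul_ne_zero hd he)
  have hU' : U = a * b * s + e * R := by rw [hU, hR, hs]; ring
  have hU0 : U ≠ 0 :=
    hU' ▸ hadd _ _ (mul_ne_zero (mul_ne_zero ha hb) hs0) (mul_ne_zero he hR0)
  have hr' : r = R * s⁻¹ := by
    rw [hr, hp, hR, ← hs]; field_simp
  have hy' : y = a * b * s * R⁻¹ := by
    rw [hy, hr']; field_simp
  have hu' : u = U * R⁻¹ := by
    rw [hu, hy', hU']; field_simp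
  have hv' : v = c * d * e * R * s⁻¹ * U⁻¹ := by
    rw [hv, hq, hu']; field_simp
  have ht' : t = R * R' * U⁻¹ := by
    have h : U + c * d * e = s * R' := by rw [hU, hR', hs]; ring
    calc t = R * (U + c * d * e) * s⁻¹ * U⁻¹ := by
          rw [ht, hr', hv']; field_simp
      _ = R * R' * U⁻¹ := by rw [h]; field_simp
  refine ⟨?_, ?_, ht', ?_, hu', ?_⟩
  · rw [hp, hr']; field_simp
  · rw [hv', ht']; field_simp
  · rw [hr', ht']; field_simp
  · rw [hy', hq, hu']; field_simp

/-- Coordinates of the comparison of the two ways around the Weyl group of type `A₃`. -/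
lemma rank_three_identities (hdist : ∀ a b c : K, a * (b + c) = a * b + a * c)
    {a b c d e f s p q r y u v t s' p' q' r' y' u' v' t' : K}
    (hs : s = c + f) (hp : p = d * f * s⁻¹) (hq : q = c * d * s⁻¹) (hr : r = a + p)
    (hy : y = a * b * r⁻¹) (hu : u = y + e) (hv : v = q * e * u⁻¹) (ht : t = r + v)
    (hs' : s' = b + e) (hp' : p' = d * e * s'⁻¹) (hq' : q' = b * d * s'⁻¹) (hr' : r' = a + p')
    (hy' : y' = a * c * r'⁻¹) (hu' : u' = y' + f) (hv' : v' = q' * f * u'⁻¹)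
    (ht' : t' = r' + v') :
    s' * v' * t'⁻¹ = b * p * r⁻¹ ∧ c * p' * r'⁻¹ = s * v * t⁻¹ ∧ t' = t ∧
      u' = r * s * t⁻¹ ∧ r' * s' * t'⁻¹ = u ∧ y' * q' * u'⁻¹ = y * q * u⁻¹ := by
  let _ := semifieldWithZero hdist
  have cadd : ∀ x y : K, ((x + y : K) : WithZero K) = x + y := fun _ _ => rfl
  have h0 : ∀ x : K, (x : WithZero K) ≠ 0 := fun _ => WithZero.coe_ne_zero
  have hadd : ∀ x y : WithZero K, x ≠ 0 → y ≠ 0 → x + y ≠ 0 := by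
    intro x y hx hy
    lift x to K using hx
    lift y to K using hy
    exact h0 (x + y)
  have cinj : ∀ x y : K, x = y ↔ (x : WithZero K) = y := fun _ _ => WithZero.coe_inj.symm
  simp only [cinj, cadd, WithZero.coe_mul, WithZero.coe_inv] at hs hp hq hr hy hu hv ht
  simp only [cinj, cadd, WithZero.coe_mul, WithZero.coe_inv] at hs' hp' hq' hr' hy' hu' hv' ht'
  simp only [cinj, WithZero.coe_mul, WithZero.coe_inv]
  obtain ⟨h1, h2, h3, h4, h5, h6⟩ := rank_three_closed_forms hadd (h0 a) (h0 b) (h0 c) (h0 d)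
    (h0 e) (h0 f) rfl rfl rfl hs hp hq hr hy hu hv ht
  obtain ⟨h1', h2', h3', h4', h5', h6'⟩ := rank_three_closed_forms hadd (h0 a) (h0 c) (h0 b)
    (h0 d) (h0 f) (h0 e) rfl rfl rfl hs' hp' hq' hr' hy' hu' hv' ht'
  have hU : (a * c * b + a * c * e + a * f * b + a * f * e + d * f * e : WithZero K) =
      a * b * c + a * b * f + a * e * c + a * e * f + d * e * f := by ring
  exact ⟨h2'.trans h1.symm, h1'.trans h2.symm, by rw [h3', h3, hU]; ring, by rw [h5', h4, hU],
    by rw [h4', h5, hU], by rw [h6', h6, hU]; ring⟩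

end Semifield

set_option linter.unusedSectionVars false

section Roots

/-- The symmetric bilinear form attached to `A`. -/
def form (A : Matrix I I ℤ) (x y : I → ℤ) : ℤ := ∑ i, ∑ j, x i * A i j * y j

/-- The simple root of index `i`. -/
abbrev simple (i : I) : I → ℤ := Pi.single i 1

/-- The product of simple reflections along a word. -/
def wordProd (A : Matrix I I ℤ) (l : List I) : Function.End (I → ℤ) := (l.map (sE A)).prod

/-- The action of the inverse of `wordProd A l`. -/
def wordInv (A : Matrix I I ℤ) (l : List I) (x : I → ℤ) : I → ℤ :=
  l.foldl (fun y i => sE A i y) x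

/-- A word is reduced if no shorter word has the same product. -/
def IsReduced (A : Matrix I I ℤ) (l : List I) : Prop :=
  ∀ l', wordProd A l' = wordProd A l → l.length ≤ l'.length

variable {A : Matrix I I ℤ}

lemma form_add_left (x y z : I → ℤ) : form A (x + y) z = form A x z + form A y z := by
  simp [form, add_mul, Finset.sum_add_distrib]

lemma form_add_right (x y z : I → ℤ) : form A x (y + z) = form A x y + form A x z := by
  simp [form, mul_add, Finset.sum_add_distrib]

lemma form_smul_left (n : ℤ) (x y : I → ℤ) : form A (n • x) y = n * form A x y := by
  simp [form, Finset.mul_sum, mul_assoc]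

lemma form_smul_right (n : ℤ) (x y : I → ℤ) : form A x (n • y) = n * form A x y := by
  simp only [form, Finset.mul_sum, Pi.smul_apply, smul_eq_mul]
  exact Finset.sum_congr rfl fun _ _ => Finset.sum_congr rfl fun _ _ => by ring

lemma form_sub_left (x y z : I → ℤ) : form A (x - y) z = form A x z - form A y z := by
  simp [form, sub_mul, Finset.sum_sub_distrib]

lemma form_sub_right (x y z : I → ℤ) : form A x (y - z) = form A x y - form A x z := by
  simp [form, mul_sub, Finset.sum_sub_distrib]

lemma form_simple_left (i : I) (x : I → ℤ) : form A (simple i) x = ∑ j, A i j * x j := by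
  rw [form, Finset.sum_eq_single i]
  · simp
  · intro b _ hb; simp [hb]
  · simp

lemma form_simple_simple (i j : I) : form A (simple i) (simple j) = A i j := by
  simp [form_simple_left, Pi.single_apply]

lemma form_comm (hA : IsSimplyLacedCartan A) (x y : I → ℤ) : form A x y = form A y x := by
  rw [form, Finset.sum_comm]
  exact Finset.sum_congr rfl fun i _ => Finset.sum_congr rfl fun j _ => by
    rw [hA.symm j i]; ring

/-- Reflection in an arbitrary vector `β` (of square length `2`). -/
def reflect (A : Matrix I I ℤ) (β x : I → ℤ) : I → ℤ := x - form A β x • β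

lemma sE_eq_reflect (i : I) (x : I → ℤ) : sE A i x = reflect A (simple i) x := by
  rw [reflect, form_simple_left]; rfl

lemma sE_simple (i j : I) : sE A i (simple j) = simple j - A i j • simple i := by
  rw [sE_eq_reflect, reflect, form_simple_simple]

lemma sE_sE (hA : IsSimplyLacedCartan A) (i : I) (x : I → ℤ) : sE A i (sE A i x) = x := by
  simp only [sE_eq_reflect, reflect, form_sub_right, form_smul_right, form_simple_simple, hA.diag,
    sub_smul, mul_smul]
  module

lemma form_sE_sE (hA : IsSimplyLacedCartan A) (i : I) (x y : I → ℤ) :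
    form A (sE A i x) (sE A i y) = form A x y := by
  simp only [sE_eq_reflect, reflect, form_sub_right, form_smul_right, form_sub_left,
    form_smul_left, form_simple_simple, hA.diag, form_comm hA x (simple i)]
  ring

lemma sE_sub (i : I) (x y : I → ℤ) : sE A i (x - y) = sE A i x - sE A i y := by
  simp only [sE_eq_reflect, reflect, form_sub_right, sub_smul]; abel

lemma sE_smul (i : I) (n : ℤ) (x : I → ℤ) : sE A i (n • x) = n • sE A i x := by
  simp only [sE_eq_reflect, reflect, form_smul_right, smul_sub, mul_smul]

lemma reflect_sE (hA : IsSimplyLacedCartan A) (i : I) (β x : I → ℤ) :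
    reflect A β (sE A i x) = sE A i (reflect A (sE A i β) x) := by
  have h : form A (sE A i β) x = form A β (sE A i x) := by
    rw [← form_sE_sE hA i, sE_sE hA]
  rw [reflect, reflect, sE_sub, sE_smul, sE_sE hA, h]

lemma sE_apply_of_ne {i j : I} (h : j ≠ i) (x : I → ℤ) : sE A i x j = x j := by
  simp [sE, h]

/-- Roots: vectors of square length `2`. -/
def IsRoot (A : Matrix I I ℤ) (x : I → ℤ) : Prop := form A x x = 2

lemma isRoot_simple (hA : IsSimplyLacedCartan A) (i : I) : IsRoot A (simple i) := by
  rw [IsRoot, form_simple_simple, hA.diag]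

lemma IsRoot.sE (hA : IsSimplyLacedCartan A) {x : I → ℤ} (hx : IsRoot A x) (i : I) :
    IsRoot A (sE A i x) := by
  rw [IsRoot, form_sE_sE hA, hx]

lemma even_form_self (hA : IsSimplyLacedCartan A) (x : I → ℤ) : Even (form A x x) := by
  have hx : x = ∑ i, x i • simple i := by
    ext j; simp [Finset.sum_apply, Pi.single_apply]
  rw [hx]
  refine Finset.sum_induction _ (fun y => Even (form A y y)) ?_ (by simp [form]) ?_
  · intro y z hy hz
    have : form A (y + z) (y + z) = form A y y + form A z z + 2 * form A y z := by
      rw [form_add_left, form_add_right, form_add_right, form_comm hA z y]; ring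
    rw [this]
    exact (hy.add hz).add (even_two_mul _)
  · intro i _
    rw [form_smul_left, form_smul_right, form_simple_simple, hA.diag]
    exact (even_two.mul_left _).mul_left _

/-- Every root is either nonnegative or nonpositive. -/
lemma IsRoot.nonneg_or_nonpos (hA : IsSimplyLacedCartan A) {x : I → ℤ} (hx : IsRoot A x) :
    0 ≤ x ∨ x ≤ 0 := by
  by_contra! hcon
  obtain ⟨h1, h2⟩ := hcon
  set p : I → ℤ := fun i => max (x i) 0 with hp
  set n : I → ℤ := fun i => max (-x i) 0 with hn
  have hxpn : x = p - n := by
    ext i; simp only [hp, hn, Pi.sub_apply]; grind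
  have hp0 : p ≠ 0 := fun h => h2 fun i => by
    have := congrFun h i
    simp only [hp, Pi.zero_apply] at this
    simp only [Pi.zero_apply]; omega
  have hn0 : n ≠ 0 := fun h => h1 fun i => by
    have := congrFun h i
    simp only [hn, Pi.zero_apply] at this
    simp only [Pi.zero_apply]; omega
  have hpp : 0 < form A p p := hA.posDef p hp0
  have hnn : 0 < form A n n := hA.posDef n hn0
  obtain ⟨u, hu⟩ := even_form_self hA p
  obtain ⟨v, hv⟩ := even_form_self hA n
  have hpn : form A p n ≤ 0 := by
    refine Finset.sum_nonpos fun i _ => Finset.sum_nonpos fun j _ => ?_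
    rcases eq_or_ne i j with rfl | hij
    · have : p i * n i = 0 := by
        simp only [hp, hn, mul_eq_zero]; omega
      have h3 : p i * A i i * n i = A i i * (p i * n i) := by ring
      rw [h3, this, mul_zero]
    · have hpi : 0 ≤ p i := le_max_right _ _
      have hnj : 0 ≤ n j := le_max_right _ _
      rcases hA.offDiag i j hij with h | h <;> rw [h]
      · simp
      · nlinarith [mul_nonneg hpi hnj]
  have hxx : form A x x = form A p p + form A n n - 2 * form A p n := by
    rw [hxpn, form_sub_left, form_sub_right, form_sub_right, form_comm hA n p]; ring
  rw [IsRoot] at hx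
  omega

/-- A simple reflection permutes the positive roots other than its own simple root. -/
lemma IsRoot.sE_nonneg (hA : IsSimplyLacedCartan A) {x : I → ℤ} (hx : IsRoot A x)
    (h0 : 0 ≤ x) {i : I} (hi : x ≠ simple i) : 0 ≤ Lusztig.sE A i x := by
  rcases (hx.sE hA i).nonneg_or_nonpos hA with h | h
  · exact h
  exfalso
  have hxi : x = x i • simple i := by
    ext j
    rcases eq_or_ne j i with rfl | hj
    · simp
    · have h3 := h j
      rw [sE_apply_of_ne hj] at h3
      have h4 : x j = 0 := le_antisymm h3 (h0 j)
      simp [hj, h4]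
  have hf : x i * (x i * 2) = 2 := by
    have h5 := hx
    rw [IsRoot, hxi, form_smul_left, form_smul_right, form_simple_simple, hA.diag] at h5
    simpa using h5
  have hone : x i = 1 := by
    have := h0 i
    simp only [Pi.zero_apply] at this
    nlinarith
  exact hi (by rw [hxi, hone, one_smul])

@[simp] lemma wordProd_cons (i : I) (l : List I) (x : I → ℤ) :
    wordProd A (i :: l) x = sE A i (wordProd A l x) := by
  simp only [wordProd, List.map_cons, List.prod_cons]; rfl

@[simp] lemma wordInv_cons (i : I) (l : List I) (x : I → ℤ) :
    wordInv A (i :: l) x = wordInv A l (sE A i x) := rfl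

lemma wordInv_sub (l : List I) (x y : I → ℤ) :
    wordInv A l (x - y) = wordInv A l x - wordInv A l y := by
  induction l generalizing x y with
  | nil => rfl
  | cons i l ih => simp [sE_sub, ih]

lemma wordInv_smul (l : List I) (n : ℤ) (x : I → ℤ) :
    wordInv A l (n • x) = n • wordInv A l x := by
  induction l generalizing x with
  | nil => rfl
  | cons i l ih => simp only [wordInv_cons, sE_smul, ih]

lemma IsRoot.wordInv (hA : IsSimplyLacedCartan A) (l : List I) {x : I → ℤ} (hx : IsRoot A x) :
    IsRoot A (wordInv A l x) := by
  induction l generalizing x with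
  | nil => exact hx
  | cons i l ih => exact ih (hx.sE hA i)

lemma wordProd_wordInv (hA : IsSimplyLacedCartan A) (l : List I) (x : I → ℤ) :
    wordProd A l (wordInv A l x) = x := by
  induction l generalizing x with
  | nil => rfl
  | cons i l ih => simp [ih, sE_sE hA]

lemma wordInv_wordProd (hA : IsSimplyLacedCartan A) (l : List I) (x : I → ℤ) :
    wordInv A l (wordProd A l x) = x := by
  induction l generalizing x with
  | nil => rfl
  | cons i l ih => simp [ih, sE_sE hA]

lemma wordInv_congr (hA : IsSimplyLacedCartan A) {l l' : List I}
    (h : wordProd A l = wordProd A l') : wordInv A l = wordInv A l' := by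
  funext x
  rw [← wordInv_wordProd hA l' (wordInv A l x), ← h, wordProd_wordInv hA]

lemma wordProd_cons_inj (hA : IsSimplyLacedCartan A) {i : I} {l l' : List I} :
    wordProd A (i :: l) = wordProd A (i :: l') ↔ wordProd A l = wordProd A l' := by
  constructor
  · intro h
    funext x
    have := congrFun h x
    simp only [wordProd_cons] at this
    rw [← sE_sE hA i (wordProd A l x), this, sE_sE hA]
  · intro h
    funext x
    simp [h]

/-- Exchange property. -/
lemma exists_deletion (hA : IsSimplyLacedCartan A) (l : List I) {β : I → ℤ} (hβ : IsRoot A β)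
    (h0 : 0 ≤ β) (hneg : wordInv A l β ≤ 0) :
    ∃ l' : List I, l'.length + 1 = l.length ∧
      ∀ x, reflect A β (wordProd A l x) = wordProd A l' x := by
  induction l generalizing β with
  | nil =>
    have : β = 0 := le_antisymm hneg h0
    rw [IsRoot, this] at hβ
    simp [form] at hβ
  | cons i l ih =>
    rcases eq_or_ne β (simple i) with rfl | hi
    · refine ⟨l, rfl, fun x => ?_⟩
      rw [← sE_eq_reflect, wordProd_cons, sE_sE hA]
    · obtain ⟨l', hl, h⟩ := ih (hβ.sE hA i) (hβ.sE_nonneg hA h0 hi) hneg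
      refine ⟨i :: l', by simp [hl], fun x => ?_⟩
      rw [wordProd_cons, reflect_sE hA, h, wordProd_cons]

lemma simple_nonneg (i : I) : (0 : I → ℤ) ≤ simple i := by
  intro j; by_cases h : j = i <;> simp [h]

lemma IsReduced.tail (hA : IsSimplyLacedCartan A) {i : I} {l : List I}
    (h : IsReduced A (i :: l)) : IsReduced A l := fun l' hl' => by
  simpa using h (i :: l') ((wordProd_cons_inj hA).2 hl')

lemma IsReduced.congr {l l' : List I} (h : IsReduced A l) (hp : wordProd A l' = wordProd A l)
    (hl : l'.length = l.length) : IsReduced A l' := fun l'' h'' => by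
  rw [hl]; exact h l'' (h''.trans hp)

lemma exists_cons_of_wordInv_nonpos (hA : IsSimplyLacedCartan A) {l : List I} {i : I}
    (hi : wordInv A l (simple i) ≤ 0) :
    ∃ u, wordProd A (i :: u) = wordProd A l ∧ (i :: u).length = l.length := by
  obtain ⟨u, hu, hp⟩ := exists_deletion hA l (isRoot_simple hA i) (simple_nonneg i) hi
  refine ⟨u, ?_, hu⟩
  funext x
  rw [wordProd_cons, ← hp, ← sE_eq_reflect, sE_sE hA]

lemma IsReduced.wordInv_head (hA : IsSimplyLacedCartan A) {i : I} {l : List I}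
    (h : IsReduced A (i :: l)) : Lusztig.wordInv A (i :: l) (simple i) ≤ 0 := by
  have h1 : sE A i (simple i) = (-1 : ℤ) • simple i := by
    rw [sE_simple, hA.diag]; module
  rw [wordInv_cons, h1, wordInv_smul]
  rcases ((isRoot_simple hA i).wordInv hA l).nonneg_or_nonpos hA with h2 | h2
  · simpa using h2
  · exfalso
    obtain ⟨u, hu, hp⟩ := exists_deletion hA l (isRoot_simple hA i) (simple_nonneg i) h2
    have := h u (by
      funext x
      rw [wordProd_cons, ← hp, ← sE_eq_reflect])
    simp at this
    omega

/-- `N` holds for all the inversions encountered along the word `p`. -/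
def AllInversions (A : Matrix I I ℤ) : ((I → ℤ) → Prop) → List I → Prop
  | _, [] => True
  | N, k :: p => N (simple k) ∧ AllInversions A (fun x => N (sE A k x)) p

lemma IsReduced.exists_append (hA : IsSimplyLacedCartan A) (p : List I) {l : List I}
    (h : IsReduced A l) (hp : AllInversions A (fun x => Lusztig.wordInv A l x ≤ 0) p) :
    ∃ u, wordProd A (p ++ u) = wordProd A l ∧ (p ++ u).length = l.length := by
  induction p generalizing l with
  | nil => exact ⟨l, rfl, rfl⟩
  | cons k p ih =>
    obtain ⟨v, hv, hvl⟩ := exists_cons_of_wordInv_nonpos hA hp.1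
    have hred := (h.congr hv hvl).tail hA
    obtain ⟨u, hu, hul⟩ := ih hred (by
      have := hp.2
      rw [← wordInv_congr hA hv] at this
      simpa [sE_sE hA] using this)
    refine ⟨u, ?_, by simpa [hul] using hvl⟩
    rw [List.cons_append, ← hv, wordProd_cons_inj hA, hu]

end Roots

section Moves

variable {A : Matrix I I ℤ} {K : Type*} [CommGroup K] [AddCommSemigroup K]

/-- A word together with labels in `K`. -/
abbrev LWord (I K : Type*) := List (I × K)

/-- The underlying word of a labelled word. -/
abbrev letters (L : LWord I K) : List I := L.map Prod.fst

/-- A braid move at the beginning of a labelled word. -/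
inductive HeadMove (A : Matrix I I ℤ) : LWord I K → LWord I K → Prop
  | braid (i j : I) (a b c : K) (t : LWord I K) : A i j = -1 →
      HeadMove A ((i, a) :: (j, b) :: (i, c) :: t)
        ((j, b * c * (a + c)⁻¹) :: (i, a + c) :: (j, a * b * (a + c)⁻¹) :: t)
  | comm (i j : I) (a b : K) (t : LWord I K) : A i j = 0 →
      HeadMove A ((i, a) :: (j, b) :: t) ((j, b) :: (i, a) :: t)

/-- A braid move anywhere in a labelled word. -/
inductive Move (A : Matrix I I ℤ) : LWord I K → LWord I K → Prop
  | head {L L' : LWord I K} : HeadMove A L L' → Move A L L'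
  | cons (x : I × K) {L L' : LWord I K} : Move A L L' → Move A (x :: L) (x :: L')

/-- The equivalence relation generated by braid moves. -/
def MoveEqv (A : Matrix I I ℤ) : LWord I K → LWord I K → Prop := Relation.EqvGen (Move A)

/-- Equality of the first labelled letters and equivalence of the tails. -/
def TailEqv (A : Matrix I I ℤ) (L L' : LWord I K) : Prop :=
  ∃ x t t', L = x :: t ∧ L' = x :: t' ∧ MoveEqv A t t'

/-- `L` and `L'` are related by a head move, up to equivalence of tails. -/
def HeadEqv (A : Matrix I I ℤ) (L L' : LWord I K) : Prop :=
  ∃ M M', TailEqv A L M ∧ HeadMove A M M' ∧ TailEqv A M' L'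

lemma MoveEqv.refl (L : LWord I K) : MoveEqv A L L := Relation.EqvGen.refl _

lemma MoveEqv.symm {L L' : LWord I K} (h : MoveEqv A L L') : MoveEqv A L' L :=
  Relation.EqvGen.symm _ _ h

lemma MoveEqv.trans {L L' L'' : LWord I K} (h : MoveEqv A L L') (h' : MoveEqv A L' L'') :
    MoveEqv A L L'' := Relation.EqvGen.trans _ _ _ h h'

lemma MoveEqv.cons (x : I × K) {L L' : LWord I K} (h : MoveEqv A L L') :
    MoveEqv A (x :: L) (x :: L') := by
  induction h with
  | rel _ _ h => exact .rel _ _ (.cons x h)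
  | refl => exact .refl _
  | symm _ _ _ ih => exact ih.symm
  | trans _ _ _ _ _ ih ih' => exact ih.trans ih'

lemma HeadMove.moveEqv {L L' : LWord I K} (h : HeadMove A L L') : MoveEqv A L L' :=
  .rel _ _ (.head h)

lemma MoveEqv.braid (i j : I) (a b c : K) (t : LWord I K) (h : A i j = -1) :
    MoveEqv A ((i, a) :: (j, b) :: (i, c) :: t)
      ((j, b * c * (a + c)⁻¹) :: (i, a + c) :: (j, a * b * (a + c)⁻¹) :: t) :=
  (HeadMove.braid i j a b c t h).moveEqv

lemma MoveEqv.comm (i j : I) (a b : K) (t : LWord I K) (h : A i j = 0) :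
    MoveEqv A ((i, a) :: (j, b) :: t) ((j, b) :: (i, a) :: t) :=
  (HeadMove.comm i j a b t h).moveEqv

lemma HeadMove.symm (hA : IsSimplyLacedCartan A)
    (hdist : ∀ a b c : K, a * (b + c) = a * b + a * c) {L L' : LWord I K}
    (h : HeadMove A L L') : HeadMove A L' L := by
  cases h with
  | braid i j a b c t h =>
    have hs : b * c * (a + c)⁻¹ + a * b * (a + c)⁻¹ = b := by
      have h1 : b * c * (a + c)⁻¹ + a * b * (a + c)⁻¹ = (b * (a + c)⁻¹) * (c + a) := by
        rw [hdist, mul_right_comm b, mul_comm a b, mul_right_comm b a]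
      rw [h1, add_comm c a, inv_mul_cancel_right]
    have key := HeadMove.braid j i (b * c * (a + c)⁻¹) (a + c) (a * b * (a + c)⁻¹) t
      ((hA.symm j i).trans h)
    rw [hs] at key
    have e1 : (a + c) * (a * b * (a + c)⁻¹) * b⁻¹ = a := by
      rw [mul_left_comm, mul_inv_cancel, mul_one, mul_inv_cancel_right]
    have e2 : b * c * (a + c)⁻¹ * (a + c) * b⁻¹ = c := by
      rw [inv_mul_cancel_right, mul_inv_cancel_comm]
    rwa [e1, e2] at key
  | comm i j a b t h => exact .comm j i b a t ((hA.symm j i).trans h)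

lemma TailEqv.mk (x : I × K) {t t' : LWord I K} (h : MoveEqv A t t') :
    TailEqv A (x :: t) (x :: t') := ⟨x, t, t', rfl, rfl, h⟩

lemma TailEqv.symm {L L' : LWord I K} (h : TailEqv A L L') : TailEqv A L' L := by
  obtain ⟨x, t, t', rfl, rfl, h⟩ := h
  exact .mk x h.symm

lemma TailEqv.trans {L L' L'' : LWord I K} (h : TailEqv A L L') (h' : TailEqv A L' L'') :
    TailEqv A L L'' := by
  obtain ⟨x, t, t', rfl, rfl, h⟩ := h
  obtain ⟨y, u, u', hu, rfl, h'⟩ := h'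
  obtain ⟨rfl, rfl⟩ := List.cons.inj hu
  exact .mk x (h.trans h')

lemma TailEqv.moveEqv {L L' : LWord I K} (h : TailEqv A L L') : MoveEqv A L L' := by
  obtain ⟨x, t, t', rfl, rfl, h⟩ := h
  exact h.cons x

lemma HeadMove.left_ne_nil {L L' : LWord I K} (h : HeadMove A L L') : L ≠ [] := by
  cases h <;> simp

lemma HeadMove.right_ne_nil {L L' : LWord I K} (h : HeadMove A L L') : L' ≠ [] := by
  cases h <;> simp

lemma TailEqv.refl {L : LWord I K} (h : L ≠ []) : TailEqv A L L := by
  cases L with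
  | nil => exact absurd rfl h
  | cons x t => exact .mk x (.refl t)

lemma HeadMove.headEqv {L L' : LWord I K} (h : HeadMove A L L') : HeadEqv A L L' :=
  ⟨L, L', .refl h.left_ne_nil, h, .refl h.right_ne_nil⟩

lemma HeadEqv.symm (hA : IsSimplyLacedCartan A)
    (hdist : ∀ a b c : K, a * (b + c) = a * b + a * c) {L L' : LWord I K}
    (h : HeadEqv A L L') : HeadEqv A L' L := by
  obtain ⟨M, M', h1, h2, h3⟩ := h
  exact ⟨M', M, h3.symm, h2.symm hA hdist, h1.symm⟩

lemma TailEqv.trans_headEqv {L L' L'' : LWord I K} (h : TailEqv A L L')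
    (h' : HeadEqv A L' L'') : HeadEqv A L L'' := by
  obtain ⟨M, M', h1, h2, h3⟩ := h'
  exact ⟨M, M', h.trans h1, h2, h3⟩

lemma HeadEqv.trans_tailEqv {L L' L'' : LWord I K} (h : HeadEqv A L L')
    (h' : TailEqv A L' L'') : HeadEqv A L L'' := by
  obtain ⟨M, M', h1, h2, h3⟩ := h
  exact ⟨M, M', h1, h2, h3.trans h'⟩

lemma HeadEqv.moveEqv {L L' : LWord I K} (h : HeadEqv A L L') : MoveEqv A L L' := by
  obtain ⟨M, M', h1, h2, h3⟩ := h
  exact h1.moveEqv.trans (h2.moveEqv.trans h3.moveEqv)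

lemma sE_comm (hA : IsSimplyLacedCartan A) {i j : I} (h : A i j = 0) (x : I → ℤ) :
    sE A i (sE A j x) = sE A j (sE A i x) := by
  have h' : A j i = 0 := (hA.symm j i).trans h
  simp only [sE_eq_reflect, reflect, form_sub_right, form_smul_right, form_simple_simple, h, h']
  module

lemma sE_braid (hA : IsSimplyLacedCartan A) {i j : I} (h : A i j = -1) (x : I → ℤ) :
    sE A i (sE A j (sE A i x)) = sE A j (sE A i (sE A j x)) := by
  have h' : A j i = -1 := (hA.symm j i).trans h
  simp only [sE_eq_reflect, reflect, form_sub_right, form_smul_right, form_simple_simple, h, h',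
    hA.diag]
  module

lemma HeadMove.wordProd_eq (hA : IsSimplyLacedCartan A) {L L' : LWord I K}
    (h : HeadMove A L L') : wordProd A (letters L) = wordProd A (letters L') := by
  funext x
  cases h with
  | braid i j a b c t h => simp [sE_braid hA h]
  | comm i j a b t h => simp [sE_comm hA h]

lemma HeadMove.length_eq {L L' : LWord I K}
    (h : HeadMove A L L') : L.length = L'.length := by
  cases h <;> simp

lemma MoveEqv.wordProd_eq (hA : IsSimplyLacedCartan A) {L L' : LWord I K}
    (h : MoveEqv A L L') : wordProd A (letters L) = wordProd A (letters L') := by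
  induction h with
  | rel L L' h =>
    induction h with
    | head h => exact h.wordProd_eq hA
    | cons x _ ih => exact (wordProd_cons_inj hA).2 ih
  | refl => rfl
  | symm _ _ _ ih => exact ih.symm
  | trans _ _ _ _ _ ih ih' => exact ih.trans ih'

lemma MoveEqv.length_eq {L L' : LWord I K} (h : MoveEqv A L L') : L.length = L'.length := by
  induction h with
  | rel L L' h =>
    induction h with
    | head h => exact h.length_eq
    | cons x _ ih => simpa using ih
  | refl => rfl
  | symm _ _ _ ih => exact ih.symm
  | trans _ _ _ _ _ ih ih' => exact ih.trans ih'

lemma MoveEqv.isReduced (hA : IsSimplyLacedCartan A) {L L' : LWord I K}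
    (h : MoveEqv A L L') (hL : IsReduced A (letters L)) : IsReduced A (letters L') :=
  hL.congr (h.wordProd_eq hA).symm (by simp [h.length_eq])

/-- Reduced words of the same element with distinct first letters can be completed to
reduced words of that element to which a head move applies. -/
lemma exists_headMove_word (hA : IsSimplyLacedCartan A) {l : List I} (hl : IsReduced A l)
    {i j : I} (hij : i ≠ j) (hi : wordInv A l (simple i) ≤ 0) (hj : wordInv A l (simple j) ≤ 0) :
    (A i j = 0 ∧ ∃ u, wordProd A (i :: j :: u) = wordProd A l ∧
      (i :: j :: u).length = l.length) ∨
    (A i j = -1 ∧ ∃ u, wordProd A (i :: j :: i :: u) = wordProd A l ∧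
      (i :: j :: i :: u).length = l.length) := by
  rcases hA.offDiag i j hij with h | h
  · refine .inl ⟨h, hl.exists_append hA [i, j] ?_⟩
    simp [AllInversions, sE_simple, h, hi, hj]
  · refine .inr ⟨h, hl.exists_append hA [i, j, i] ?_⟩
    have h' : A j i = -1 := (hA.symm j i).trans h
    refine ⟨hi, fun m => ?_, fun m => ?_, trivial⟩ <;>
    · have := hi m
      have := hj m
      simp only [sE_simple, sE_sub, sE_smul, wordInv_sub, wordInv_smul, h, h', hA.diag,
        Pi.sub_apply, Pi.smul_apply, Pi.zero_apply, smul_eq_mul] at *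
      linarith

/-- Matsumoto's theorem for labelled words. -/
theorem exists_moveEqv (hA : IsSimplyLacedCartan A) (L : LWord I K) (g : List I)
    (hL : IsReduced A (letters L)) (hg : wordProd A g = wordProd A (letters L))
    (hlen : g.length = L.length) : ∃ L', letters L' = g ∧ MoveEqv A L L' := by
  induction hn : L.length generalizing L g with
  | zero =>
    rw [List.length_eq_zero_iff] at hn
    subst hn
    simp only [List.length_nil, List.length_eq_zero_iff] at hlen
    exact ⟨[], by simp [hlen], .refl _⟩
  | succ n ih =>
    have same : ∀ (i : I) (a : K) (t : LWord I K) (g : List I), t.length = n → g.length = n →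
        IsReduced A (i :: letters t) → wordProd A (i :: g) = wordProd A (i :: letters t) →
        ∃ L', letters L' = i :: g ∧ MoveEqv A ((i, a) :: t) L' := by
      intro i a t g ht hg hred hp
      obtain ⟨t', h1, h2⟩ := ih t g (hred.tail hA) ((wordProd_cons_inj hA).1 hp)
        (by rw [ht, hg]) ht
      exact ⟨(i, a) :: t', by simp [h1], h2.cons _⟩
    obtain _ | ⟨⟨i, a⟩, t⟩ := L
    · simp at hn
    obtain _ | ⟨j, g⟩ := g
    · simp at hlen
    simp only [List.length_cons, Nat.add_right_cancel_iff] at hn hlen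
    rw [hn] at hlen
    simp only [letters, List.map_cons] at hL hg
    rcases eq_or_ne i j with rfl | hij
    · exact same i a t g hn hlen hL hg
    have hgred : IsReduced A (j :: g) := hL.congr hg (by simp [hlen, hn])
    have hi := hL.wordInv_head hA
    have hj := hgred.wordInv_head hA
    rw [wordInv_congr hA hg] at hj
    have finish : ∀ M M' : LWord I K, MoveEqv A ((i, a) :: t) M → HeadMove A M M' →
        M'.head?.map Prod.fst = some j → ∃ L', letters L' = j :: g ∧
          MoveEqv A ((i, a) :: t) L' := by
      intro M M' h1 h2 h3
      have h4 := h1.trans h2.moveEqv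
      obtain _ | ⟨⟨j', b⟩, t'⟩ := M'
      · simp at h3
      obtain rfl : j' = j := by simpa using h3
      have h5 := h4.length_eq
      simp only [List.length_cons, hn, Nat.add_right_cancel_iff] at h5
      obtain ⟨L', h6, h7⟩ := same j' b t' g h5.symm hlen (h4.isReduced hA hL)
        (hg.trans (h4.wordProd_eq hA))
      exact ⟨L', h6, h4.trans h7⟩
    rcases exists_headMove_word hA hL hij hi hj with ⟨h, u, hu, hul⟩ | ⟨h, u, hu, hul⟩
    · obtain ⟨M, hM, hLM⟩ := same i a t (j :: u) hn (by simpa [hn] using hul) hL hu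
      obtain ⟨⟨i', x⟩, M1, rfl, rfl, hM1⟩ := List.map_eq_cons_iff.1 hM
      obtain ⟨⟨j', y⟩, M2, rfl, rfl, hM2⟩ := List.map_eq_cons_iff.1 hM1
      exact finish _ _ hLM (.comm _ _ _ _ _ h) rfl
    · obtain ⟨M, hM, hLM⟩ := same i a t (j :: i :: u) hn (by simpa [hn] using hul) hL hu
      obtain ⟨⟨i', x⟩, M1, rfl, rfl, hM1⟩ := List.map_eq_cons_iff.1 hM
      obtain ⟨⟨j', y⟩, M2, rfl, rfl, hM2⟩ := List.map_eq_cons_iff.1 hM1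
      obtain ⟨⟨i'', z⟩, M3, rfl, hz, hM3⟩ := List.map_eq_cons_iff.1 hM2
      obtain rfl : i'' = i' := hz
      exact finish _ _ hLM (.braid _ _ _ _ _ _ h) rfl

end Moves

section Monodromy

variable {A : Matrix I I ℤ} {K : Type*} [CommGroup K] [AddCommSemigroup K]

/-- The first letter of `L` is `i`. -/
def StartsWith (i : I) (L : LWord I K) : Prop := ∃ a t, L = (i, a) :: t

lemma exists_cons_of_letters_eq {t : LWord I K} {i : I} {g : List I} (h : letters t = i :: g) :
    ∃ a u, t = (i, a) :: u ∧ letters u = g := by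
  obtain ⟨⟨_, a⟩, u, rfl, rfl, h'⟩ := List.map_eq_cons_iff.1 h
  exact ⟨a, u, rfl, h'⟩

lemma StartsWith.of_tailEqv {i : I} {L L' : LWord I K} (h : StartsWith i L)
    (h' : TailEqv A L L') : StartsWith i L' := by
  obtain ⟨a, t, rfl⟩ := h
  obtain ⟨x, u, u', hu, rfl, -⟩ := h'
  obtain ⟨rfl, rfl⟩ := List.cons.inj hu
  exact ⟨a, u', rfl⟩

lemma StartsWith.eq {i j : I} {L : LWord I K} (h : StartsWith i L)
    (h' : StartsWith j L) : i = j := by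
  obtain ⟨a, t, rfl⟩ := h
  obtain ⟨b, u, hu⟩ := h'
  simp_all

lemma StartsWith.wordInv (hA : IsSimplyLacedCartan A) {i : I} {L : LWord I K}
    (h : StartsWith i L) (hL : IsReduced A (letters L)) :
    Lusztig.wordInv A (letters L) (simple i) ≤ 0 := by
  obtain ⟨a, t, rfl⟩ := h
  exact hL.wordInv_head hA

lemma HeadMove.exists_startsWith {L L' : LWord I K} (h : HeadMove A L L') :
    ∃ i j, A i j ≤ 0 ∧ StartsWith i L ∧ StartsWith j L' := by
  cases h with
  | braid i j a b c t h => exact ⟨i, j, by omega, ⟨_, _, rfl⟩, ⟨_, _, rfl⟩⟩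
  | comm i j a b t h => exact ⟨i, j, by omega, ⟨_, _, rfl⟩, ⟨_, _, rfl⟩⟩

lemma HeadEqv.exists_startsWith (hA : IsSimplyLacedCartan A) {L L' : LWord I K}
    (h : HeadEqv A L L') : ∃ i j, i ≠ j ∧ StartsWith i L ∧ StartsWith j L' := by
  obtain ⟨M, M', h1, h2, h3⟩ := h
  obtain ⟨i, j, hij, hi, hj⟩ := h2.exists_startsWith
  refine ⟨i, j, ?_, hi.of_tailEqv h1.symm, hj.of_tailEqv h3⟩
  rintro rfl
  rw [hA.diag] at hij
  omega

/-- A labelled word can be moved to any word of the same element with the same first letter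
without touching the first label. -/
lemma exists_tailEqv (hA : IsSimplyLacedCartan A) {i : I} {L : LWord I K} (g : List I)
    (hi : StartsWith i L) (hL : IsReduced A (letters L))
    (hg : wordProd A (i :: g) = wordProd A (letters L))
    (hlen : (i :: g).length = (letters L).length) :
    ∃ a t, letters t = g ∧ TailEqv A L ((i, a) :: t) := by
  obtain ⟨a, t, rfl⟩ := hi
  obtain ⟨t', h1, h2⟩ := exists_moveEqv hA t g (hL.tail hA) ((wordProd_cons_inj hA).1 hg)
    (by simpa using hlen)
  exact ⟨a, t', h1, .mk _ h2⟩

lemma exists_headEqv (hA : IsSimplyLacedCartan A) {i j : I} {L : LWord I K}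
    (hL : IsReduced A (letters L)) (hij : i ≠ j) (hi : StartsWith i L)
    (hj : wordInv A (letters L) (simple j) ≤ 0) :
    ∃ L', StartsWith j L' ∧ HeadEqv A L L' := by
  rcases exists_headMove_word hA hL hij (hi.wordInv hA hL) hj with
    ⟨h, u, hu, hul⟩ | ⟨h, u, hu, hul⟩
  · obtain ⟨a, t, ht, hLt⟩ := exists_tailEqv hA _ hi hL hu hul
    obtain ⟨y, t1, rfl, -⟩ := exists_cons_of_letters_eq ht
    exact ⟨_, ⟨_, _, rfl⟩, hLt.trans_headEqv (HeadMove.comm _ _ _ _ _ h).headEqv⟩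
  · obtain ⟨a, t, ht, hLt⟩ := exists_tailEqv hA _ hi hL hu hul
    obtain ⟨y, t1, rfl, h1⟩ := exists_cons_of_letters_eq ht
    obtain ⟨z, t2, rfl, -⟩ := exists_cons_of_letters_eq h1
    exact ⟨_, ⟨_, _, rfl⟩, hLt.trans_headEqv (HeadMove.braid _ _ _ _ _ _ h).headEqv⟩

/-- Equivalent labelled reduced words of length `n` with the same underlying word are equal. -/
def UniqueLabels (A : Matrix I I ℤ) (K : Type*) [CommGroup K] [AddCommSemigroup K] (n : ℕ) :
    Prop :=
  ∀ L L' : LWord I K, MoveEqv A L L' → L.length = n → IsReduced A (letters L) →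
    letters L = letters L' → L = L'

lemma wordProd_append_inj (hA : IsSimplyLacedCartan A) (p : List I) {l l' : List I}
    (h : wordProd A (p ++ l) = wordProd A (p ++ l')) : wordProd A l = wordProd A l' := by
  induction p with
  | nil => exact h
  | cons i p ih => exact ih ((wordProd_cons_inj hA).1 h)

lemma IsReduced.of_append (hA : IsSimplyLacedCartan A) (p : List I) {l : List I}
    (h : IsReduced A (p ++ l)) : IsReduced A l := by
  induction p with
  | nil => exact h
  | cons i p ih => exact ih (h.tail hA)

lemma MoveEqv.append (p : LWord I K) {L L' : LWord I K} (h : MoveEqv A L L') :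
    MoveEqv A (p ++ L) (p ++ L') := by
  induction p with
  | nil => exact h
  | cons x p ih => exact ih.cons x

/-- Equivalent labelled words with a common prefix of letters have equal labels on this
prefix and equivalent remainders. -/
lemma UniqueLabels.append_inj (hA : IsSimplyLacedCartan A) {n : ℕ} (hU : UniqueLabels A K n)
    {p p' t t' : LWord I K} (h : MoveEqv A (p ++ t) (p' ++ t')) (hn : (p ++ t).length = n)
    (hred : IsReduced A (letters (p ++ t))) (hp : letters p = letters p') :
    p = p' ∧ MoveEqv A t t' := by
  have h1 := h.wordProd_eq hA
  have h2 := h.length_eq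
  have h3 : p.length = p'.length := by simpa using congrArg List.length hp
  simp only [letters, List.map_append, List.length_append] at *
  rw [hp] at h1 hred
  obtain ⟨t'', ht, htt⟩ := exists_moveEqv hA t (letters t') (hred.of_append hA)
    (wordProd_append_inj hA _ h1).symm (by simp; omega)
  have h4 := hU (p ++ t'') (p' ++ t') ((htt.append p).symm.trans h)
    (by simp [← htt.length_eq, hn]) ?_ (by simp [hp, ht])
  · obtain ⟨rfl, rfl⟩ := List.append_inj h4 h3
    exact ⟨rfl, htt⟩
  · refine ((htt.append p).isReduced hA ?_)
    simpa [hp] using hred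

lemma HeadMove.tailEqv_of_tailEqv (hA : IsSimplyLacedCartan A) {n : ℕ}
    (hU : UniqueLabels A K n) {j : I} {M N M' N' : LWord I K} (hM : IsReduced A (letters M))
    (hn : M.length = n + 1) (h : TailEqv A M N) (hMM : HeadMove A M M') (hNN : HeadMove A N N')
    (hjM : StartsWith j M') (hjN : StartsWith j N') : TailEqv A M' N' := by
  obtain ⟨x, t, t', rfl, rfl, h⟩ := h
  obtain ⟨b, u, rfl⟩ := hjM
  obtain ⟨b', u', rfl⟩ := hjN
  have hred := hM.tail hA
  cases hMM with
  | braid i _ a b c t hij =>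
    cases hNN with
    | braid i _ a b' c' t' hij' =>
      obtain ⟨h1, h2⟩ := hU.append_inj hA (p := [(j, b), (i, c)]) (p' := [(j, b'), (i, c')]) h
        (by simpa using hn) hred rfl
      simp only [List.cons.injEq, Prod.mk.injEq, true_and, and_true] at h1
      obtain ⟨rfl, rfl⟩ := h1
      exact .mk _ ((h2.cons _).cons _)
    | comm i _ a b' t' hij' => omega
  | comm i _ a b t hij =>
    cases hNN with
    | braid i _ a b' c' t' hij' => omega
    | comm i _ a b' t' hij' =>
      obtain ⟨h1, h2⟩ := hU.append_inj hA (p := [(j, b)]) (p' := [(j, b')]) h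
        (by simpa using hn) hred rfl
      simp only [List.cons.injEq, Prod.mk.injEq, true_and, and_true] at h1
      obtain rfl := h1
      exact .mk _ (h2.cons _)

lemma HeadEqv.tailEqv (hA : IsSimplyLacedCartan A) {n : ℕ} (hU : UniqueLabels A K n) {j : I}
    {L L' L'' : LWord I K} (hL : IsReduced A (letters L)) (hn : L.length = n + 1)
    (h' : HeadEqv A L L') (h'' : HeadEqv A L L'') (hj' : StartsWith j L')
    (hj'' : StartsWith j L'') : TailEqv A L' L'' := by
  obtain ⟨M, M', h1, h2, h3⟩ := h'
  obtain ⟨N, N', k1, k2, k3⟩ := h''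
  exact h3.symm.trans ((h2.tailEqv_of_tailEqv hA hU (h1.moveEqv.isReduced hA hL)
    (by rw [← h1.moveEqv.length_eq, hn]) (h1.symm.trans k1) k2 (hj'.of_tailEqv h3.symm)
    (hj''.of_tailEqv k3.symm)).trans k3)

/-- Labelled reduced words of length `n` starting with `i` for elements with left descents
`i`, `j`, `k` fit into a triangle of head moves. -/
def HasTriangles (A : Matrix I I ℤ) (K : Type*) [CommGroup K] [AddCommSemigroup K] (n : ℕ)
    (i j k : I) : Prop :=
  ∀ L : LWord I K, L.length = n → IsReduced A (letters L) → StartsWith i L →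
    wordInv A (letters L) (simple j) ≤ 0 → wordInv A (letters L) (simple k) ≤ 0 →
    ∃ L' L'', StartsWith j L' ∧ StartsWith k L'' ∧ HeadEqv A L L' ∧ HeadEqv A L' L'' ∧
      HeadEqv A L L''

lemma HasTriangles.swap (hA : IsSimplyLacedCartan A)
    (hdist : ∀ a b c : K, a * (b + c) = a * b + a * c) {n : ℕ} {i j k : I}
    (h : HasTriangles A K n i j k) : HasTriangles A K n i k j := by
  intro L hn hL hi hk hj
  obtain ⟨L', L'', h1, h2, h3, h4, h5⟩ := h L hn hL hi hj hk
  exact ⟨L'', L', h2, h1, h5, h4.symm hA hdist, h3⟩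

lemma HasTriangles.rebase (hA : IsSimplyLacedCartan A)
    (hdist : ∀ a b c : K, a * (b + c) = a * b + a * c) {n : ℕ} (hU : UniqueLabels A K n)
    {i j k : I} (hij : i ≠ j) (h : HasTriangles A K (n + 1) j i k) :
    HasTriangles A K (n + 1) i j k := by
  intro L hn hL hi hj hk
  obtain ⟨L', hj', hLL'⟩ := exists_headEqv hA hL hij hi hj
  have hm := hLL'.moveEqv
  have hinv := wordInv_congr hA (hm.wordProd_eq hA)
  obtain ⟨L1, L2, h1, h2, h3, h4, h5⟩ := h L' (by rw [← hm.length_eq, hn])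
    (hm.isReduced hA hL) hj' (hinv ▸ hi.wordInv hA hL) (hinv ▸ hk)
  have hLL1 := (hLL'.symm hA hdist).tailEqv hA hU (hm.isReduced hA hL)
    (by rw [← hm.length_eq, hn]) h3 hi h1
  exact ⟨L', L2, hj', h2, hLL', h5, hLL1.trans_headEqv h4⟩

lemma hasTriangles_of_commuting (hA : IsSimplyLacedCartan A) (n : ℕ) {i j k : I}
    (hij : A i j = 0) (hik : A i k = 0) (hjk : A j k = 0) : HasTriangles A K n i j k := by
  intro L hn hL hi hj hk
  have hi' := hi.wordInv hA hL
  obtain ⟨u, hu, hul⟩ := hL.exists_append hA [i, j, k] (by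
    refine ⟨hi', ?_, ?_, trivial⟩ <;>
    simp [sE_simple, hij, hik, hjk, hj, hk])
  obtain ⟨a, t, ht, hLt⟩ := exists_tailEqv hA _ hi hL hu hul
  obtain ⟨b, t1, rfl, h1⟩ := exists_cons_of_letters_eq ht
  obtain ⟨c, t2, rfl, -⟩ := exists_cons_of_letters_eq h1
  refine ⟨_, _, ⟨_, _, rfl⟩, ⟨_, _, rfl⟩,
    hLt.trans_headEqv (HeadMove.comm _ _ _ _ _ hij).headEqv, ?_,
    (hLt.trans (.mk _ (.comm _ _ _ _ _ hjk))).trans_headEqv (HeadMove.comm _ _ _ _ _ hik).headEqv⟩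
  exact (TailEqv.mk _ (.comm _ _ _ _ _ hik)).trans_headEqv
    ((HeadMove.comm _ _ _ _ _ hjk).headEqv.trans_tailEqv (.mk _ (.comm _ _ _ _ _
      ((hA.symm _ _).trans hij))))

lemma hasTriangles_of_type_A2_A1 (hA : IsSimplyLacedCartan A) (n : ℕ) {i j k : I}
    (hij : A i j = -1) (hik : A i k = 0) (hjk : A j k = 0) : HasTriangles A K n i j k := by
  intro L hn hL hi hj hk
  have hi' := hi.wordInv hA hL
  have hji := (hA.symm j i).trans hij
  obtain ⟨u, hu, hul⟩ := hL.exists_append hA [i, j, i, k] (by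
    refine ⟨hi', fun m => ?_, fun m => ?_, fun m => ?_, trivial⟩ <;>
    · have := hi' m
      have := hj m
      have := hk m
      simp only [sE_simple, sE_sub, sE_smul, wordInv_sub, wordInv_smul, hij, hik, hjk, hji,
        hA.diag, Pi.sub_apply, Pi.smul_apply, Pi.zero_apply, smul_eq_mul] at *
      linarith)
  obtain ⟨a, t, ht, hLt⟩ := exists_tailEqv hA _ hi hL hu hul
  obtain ⟨b, t1, rfl, h1⟩ := exists_cons_of_letters_eq ht
  obtain ⟨c, t2, rfl, h2⟩ := exists_cons_of_letters_eq h1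
  obtain ⟨d, t3, rfl, -⟩ := exists_cons_of_letters_eq h2
  refine ⟨_, _, ⟨_, _, rfl⟩, ⟨_, _, rfl⟩,
    hLt.trans_headEqv (HeadMove.braid _ _ _ _ _ _ hij).headEqv, ?_,
    (hLt.trans (.mk _ (.trans (.cons _ (.comm _ _ _ _ _ hik)) (.comm _ _ _ _ _ hjk)))
      ).trans_headEqv (HeadMove.comm _ _ _ _ _ hik).headEqv⟩
  exact (TailEqv.mk _ (.trans (.cons _ (.comm _ _ _ _ _ hjk)) (.comm _ _ _ _ _ hik))
    ).trans_headEqv ((HeadMove.comm _ _ _ _ _ hjk).headEqv.trans_tailEqv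
      (.mk _ (MoveEqv.braid _ _ _ _ _ _ hij).symm))

/-- The two halves of one of the two ways around the Weyl group of type `A₃`. -/
lemma type_A3_path (hA : IsSimplyLacedCartan A) {i j k : I} (hij : A i j = -1)
    (hik : A i k = -1) (hjk : A j k = 0) {a b c d e f s p q r y u v t : K}
    (hs : s = c + f) (hp : p = d * f * s⁻¹) (hq : q = c * d * s⁻¹) (hr : r = a + p)
    (hy : y = a * b * r⁻¹) (hu : u = y + e) (hv : v = q * e * u⁻¹) (ht : t = r + v)
    (w : LWord I K) :
    HeadEqv A ((i, a) :: (j, b) :: (k, c) :: (i, d) :: (j, e) :: (k, f) :: w)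
        ((j, b * p * r⁻¹) :: (i, r) :: (j, y) :: (k, s) :: (i, q) :: (j, e) :: w) ∧
      TailEqv A ((j, b * p * r⁻¹) :: (i, r) :: (j, y) :: (k, s) :: (i, q) :: (j, e) :: w)
        ((j, b * p * r⁻¹) :: (k, s * v * t⁻¹) :: (i, t) :: (k, r * s * t⁻¹) :: (j, u) ::
          (i, y * q * u⁻¹) :: w) := by
  have hji := (hA.symm j i).trans hij
  have hki := (hA.symm k i).trans hik
  subst hs hp hq hr hy hu hv ht
  constructor
  · exact (TailEqv.mk _ (.cons _ (.trans (.cons _ (.cons _ (.comm _ _ _ _ _ hjk)))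
      (.braid _ _ _ _ _ _ hki)))).trans_headEqv (HeadMove.braid _ _ _ _ _ _ hij).headEqv
  · exact .mk _ (.trans (.cons _ (.trans (.comm _ _ _ _ _ hjk) (.cons _ (.braid _ _ _ _ _ _ hji))))
      (.braid _ _ _ _ _ _ hik))

lemma hasTriangles_of_type_A3 (hA : IsSimplyLacedCartan A)
    (hdist : ∀ a b c : K, a * (b + c) = a * b + a * c) (n : ℕ) {i j k : I}
    (hij : A i j = -1) (hik : A i k = -1) (hjk : A j k = 0) : HasTriangles A K n i j k := by
  intro L hn hL hi hj hk
  have hi' := hi.wordInv hA hL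
  have hji := (hA.symm j i).trans hij
  have hki := (hA.symm k i).trans hik
  have hkj := (hA.symm k j).trans hjk
  obtain ⟨l, hl, hll⟩ := hL.exists_append hA [i, j, k, i, j, k] (by
    refine ⟨hi', fun m => ?_, fun m => ?_, fun m => ?_, fun m => ?_, fun m => ?_, trivial⟩ <;>
    · have := hi' m
      have := hj m
      have := hk m
      simp only [sE_simple, sE_sub, sE_smul, wordInv_sub, wordInv_smul, hij, hik, hjk, hji, hki,
        hkj, hA.diag, Pi.sub_apply, Pi.smul_apply, Pi.zero_apply, smul_eq_mul] at *
      linarith)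
  obtain ⟨a, w, ht, hLt⟩ := exists_tailEqv hA _ hi hL hl hll
  obtain ⟨b, t1, rfl, h1⟩ := exists_cons_of_letters_eq ht
  obtain ⟨c, t2, rfl, h2⟩ := exists_cons_of_letters_eq h1
  obtain ⟨d, t3, rfl, h3⟩ := exists_cons_of_letters_eq h2
  obtain ⟨e, t4, rfl, h4⟩ := exists_cons_of_letters_eq h3
  obtain ⟨f, t5, rfl, -⟩ := exists_cons_of_letters_eq h4
  obtain ⟨h1, h2⟩ := type_A3_path (a := a) (b := b) (c := c) (d := d) (e := e) (f := f) hA hij hik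
    hjk rfl rfl rfl rfl rfl rfl rfl rfl t5
  obtain ⟨h1', h2'⟩ := type_A3_path (a := a) (b := c) (c := b) (d := d) (e := f) (f := e) hA hik hij
    hkj rfl rfl rfl rfl rfl rfl rfl rfl t5
  obtain ⟨e1, e2, e3, e4, e5, e6⟩ := rank_three_identities (a := a) (b := b) (c := c) (d := d)
    (e := e) (f := f) hdist rfl rfl rfl rfl rfl rfl rfl rfl rfl rfl rfl rfl rfl rfl rfl rfl
  have h3 : TailEqv A ((i, a) :: (j, b) :: (k, c) :: (i, d) :: (j, e) :: (k, f) :: t5)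
      ((i, a) :: (k, c) :: (j, b) :: (i, d) :: (k, f) :: (j, e) :: t5) :=
    .mk _ ((MoveEqv.comm _ _ _ _ _ hjk).trans
      (.cons _ (.cons _ (.cons _ (.comm _ _ _ _ _ hjk)))))
  refine ⟨_, _, ⟨_, _, rfl⟩, ⟨_, _, rfl⟩, hLt.trans_headEqv h1, ?_,
    (hLt.trans h3).trans_headEqv h1'⟩
  refine (h2.trans_headEqv (HeadMove.comm _ _ _ _ _ hjk).headEqv).trans_tailEqv
    (TailEqv.trans ?_ h2'.symm)
  rw [e1, e2, e5, e6, e3, e4]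
  exact .mk _ (.cons _ (.cons _ (.comm _ _ _ _ _ hkj)))

lemma not_affine_A2 (hA : IsSimplyLacedCartan A) {i j k : I} (hijne : i ≠ j) (hikne : i ≠ k)
    (hij : A i j = -1) (hik : A i k = -1) (hjk : A j k = -1) : False := by
  have hji := (hA.symm j i).trans hij
  have hki := (hA.symm k i).trans hik
  have hkj := (hA.symm k j).trans hjk
  have hpos := hA.posDef (simple i + simple j + simple k) (fun h => by
    have := congrFun h i
    simp [simple, hijne, hikne] at this)
  have hform : form A (simple i + simple j + simple k) (simple i + simple j + simple k) = 0 := by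
    simp only [form_add_left, form_add_right, form_simple_simple, hij, hik, hjk, hji, hki, hkj,
      hA.diag]
    norm_num
  exact absurd hform hpos.ne'

lemma UniqueLabels.hasTriangles (hA : IsSimplyLacedCartan A)
    (hdist : ∀ a b c : K, a * (b + c) = a * b + a * c) {n : ℕ} (hU : UniqueLabels A K n)
    {i j k : I} (hij : i ≠ j) (hik : i ≠ k) (hjk : j ≠ k) :
    HasTriangles A K (n + 1) i j k := by
  rcases hA.offDiag i j hij with h1 | h1 <;> rcases hA.offDiag i k hik with h2 | h2 <;>
    rcases hA.offDiag j k hjk with h3 | h3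
  · exact hasTriangles_of_commuting hA _ h1 h2 h3
  · exact .rebase hA hdist hU hij (.swap hA hdist
      (hasTriangles_of_type_A2_A1 hA _ h3 ((hA.symm _ _).trans h1) ((hA.symm _ _).trans h2)))
  · exact .swap hA hdist (hasTriangles_of_type_A2_A1 hA _ h2 h1 ((hA.symm _ _).trans h3))
  · exact .swap hA hdist (.rebase hA hdist hU hik (hasTriangles_of_type_A3 hA hdist _
      ((hA.symm _ _).trans h2) ((hA.symm _ _).trans h3) h1))
  · exact hasTriangles_of_type_A2_A1 hA _ h1 h2 h3
  · exact .rebase hA hdist hU hij (hasTriangles_of_type_A3 hA hdist _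
      ((hA.symm _ _).trans h1) h3 h2)
  · exact hasTriangles_of_type_A3 hA hdist _ h1 h2 h3
  · exact (not_affine_A2 hA hij hik h1 h2 h3).elim

lemma UniqueLabels.headEqv_trans (hA : IsSimplyLacedCartan A)
    (hdist : ∀ a b c : K, a * (b + c) = a * b + a * c) {n : ℕ} (hU : UniqueLabels A K n)
    {L L' L'' : LWord I K} (hL : IsReduced A (letters L)) (hn : L.length = n + 1)
    (h : HeadEqv A L L') (h' : HeadEqv A L L'') : TailEqv A L' L'' ∨ HeadEqv A L' L'' := by
  obtain ⟨i, j, hij, hi, hj⟩ := h.exists_startsWith hA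
  obtain ⟨i', k, hik, hi', hk⟩ := h'.exists_startsWith hA
  obtain rfl := hi.eq hi'
  rcases eq_or_ne j k with rfl | hjk
  · exact .inl (h.tailEqv hA hU hL hn h' hj hk)
  have descent : ∀ {m : I} {M : LWord I K}, HeadEqv A L M → StartsWith m M →
      wordInv A (letters L) (simple m) ≤ 0 := by
    intro m M hM hm
    rw [wordInv_congr hA (hM.moveEqv.wordProd_eq hA)]
    exact hm.wordInv hA (hM.moveEqv.isReduced hA hL)
  obtain ⟨M, M', h1, h2, h3, h4, h5⟩ := hU.hasTriangles hA hdist hij hik hjk L hn hL hi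
    (descent h hj) (descent h' hk)
  exact .inr ((h.tailEqv hA hU hL hn h3 hj h1).trans_headEqv
    (h4.trans_tailEqv (h5.tailEqv hA hU hL hn h' h2 hk)))

lemma UniqueLabels.tailEqv_or_headEqv (hA : IsSimplyLacedCartan A)
    (hdist : ∀ a b c : K, a * (b + c) = a * b + a * c) {n : ℕ} (hU : UniqueLabels A K n)
    {L L' : LWord I K} (h : MoveEqv A L L') (hL : IsReduced A (letters L))
    (hn : L.length = n + 1) : TailEqv A L L' ∨ HeadEqv A L L' := by
  induction h with
  | rel L L' h =>
    cases h with
    | head h => exact .inr h.headEqv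
    | cons x h => exact .inl (.mk x (.rel _ _ h))
  | refl L => exact .inl (.refl (List.ne_nil_of_length_eq_add_one hn))
  | symm L L' h ih =>
    have hm := MoveEqv.symm h
    exact (ih (hm.isReduced hA hL) (hm.length_eq ▸ hn)).imp .symm (.symm hA hdist)
  | trans L L' L'' h h' ih ih' =>
    have hL' := MoveEqv.isReduced hA h hL
    have hn' := MoveEqv.length_eq h ▸ hn
    rcases ih hL hn with h1 | h1 <;> rcases ih' hL' hn' with h2 | h2
    · exact .inl (h1.trans h2)
    · exact .inr (h1.trans_headEqv h2)
    · exact .inr (h1.trans_tailEqv h2)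
    · exact hU.headEqv_trans hA hdist hL' hn' (h1.symm hA hdist) h2

/-- Moves have trivial monodromy on the labels of a reduced word. -/
theorem uniqueLabels (hA : IsSimplyLacedCartan A)
    (hdist : ∀ a b c : K, a * (b + c) = a * b + a * c) (n : ℕ) : UniqueLabels A K n := by
  induction n with
  | zero =>
    intro L L' h hn _ _
    have hn' := h.length_eq ▸ hn
    rw [List.length_eq_zero_iff] at hn hn'
    rw [hn, hn']
  | succ n hU =>
    intro L L' h hn hL hLL
    rcases hU.tailEqv_or_headEqv hA hdist h hL hn with ⟨x, t, t', rfl, rfl, ht⟩ | h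
    · rw [hU t t' ht (by simpa using hn) (hL.tail hA) (by simpa using hLL)]
    · obtain ⟨i, j, hij, ⟨a, t, rfl⟩, ⟨b, t', rfl⟩⟩ := h.exists_startsWith hA
      exact absurd (List.cons.inj hLL).1 hij

/-- Equivalent labelled reduced words with the same first letter remain equivalent when
their first labels are multiplied by the same element. -/
lemma MoveEqv.rescale (hA : IsSimplyLacedCartan A)
    (hdist : ∀ a b c : K, a * (b + c) = a * b + a * c) {i : I} {a a' : K} {t t' : LWord I K}
    (h : MoveEqv A ((i, a) :: t) ((i, a') :: t')) (hred : IsReduced A (letters ((i, a) :: t)))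
    (c : K) : MoveEqv A ((i, c * a) :: t) ((i, c * a') :: t') := by
  obtain ⟨h1, h2⟩ := (uniqueLabels hA hdist _).append_inj hA (p := [(i, a)]) (p' := [(i, a')]) h
    rfl hred rfl
  simp only [List.cons.injEq, Prod.mk.injEq, true_and, and_true] at h1
  rw [h1]
  exact h2.cons _

end Monodromy

section Words

variable {A : Matrix I I ℤ} {K : Type*} [CommGroup K] [AddCommSemigroup K]

/-- The list of labelled letters of a pair of sequences. -/
def toLWord {ν : ℕ} (p : (Fin ν → I) × (Fin ν → K)) : LWord I K :=
  List.ofFn fun k => (p.1 k, p.2 k)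

@[simp] lemma length_toLWord {ν : ℕ} (p : (Fin ν → I) × (Fin ν → K)) :
    (toLWord p).length = ν := List.length_ofFn

lemma getElem?_toLWord {ν : ℕ} (p : (Fin ν → I) × (Fin ν → K)) {k : ℕ} (hk : k < ν) :
    (toLWord p)[k]? = some (p.1 ⟨k, hk⟩, p.2 ⟨k, hk⟩) := by
  simp [toLWord, hk]

lemma getElem_toLWord {ν : ℕ} (p : (Fin ν → I) × (Fin ν → K)) {k : ℕ}
    (hk : k < (toLWord p).length) : (toLWord p)[k] =
      (p.1 ⟨k, by simpa using hk⟩, p.2 ⟨k, by simpa using hk⟩) := by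
  simp [toLWord]

lemma toLWord_injective {ν : ℕ} {p q : (Fin ν → I) × (Fin ν → K)}
    (h : toLWord p = toLWord q) : p = q := by
  have h' := List.ofFn_injective h
  exact Prod.ext (funext fun k => congrArg Prod.fst (congrFun h' k))
    (funext fun k => congrArg Prod.snd (congrFun h' k))

lemma exists_toLWord_eq (L : LWord I K) {ν : ℕ} (hL : L.length = ν) :
    ∃ p : (Fin ν → I) × (Fin ν → K), toLWord p = L := by
  subst hL
  exact ⟨(fun k => (L.get k).1, fun k => (L.get k).2), List.ofFn_get L⟩

lemma letters_toLWord {ν : ℕ} (p : (Fin ν → I) × (Fin ν → K)) :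
    letters (toLWord p) = List.ofFn p.1 := by
  rw [letters, toLWord, List.map_ofFn]
  rfl

lemma mem_redWord_iff {w₀ : Function.End (I → ℤ)} {ν : ℕ} (p : (Fin ν → I) × (Fin ν → K)) :
    p.1 ∈ RedWord A w₀ ν ↔ wordProd A (letters (toLWord p)) = w₀ := by
  rw [letters_toLWord]
  rfl

lemma isReduced_of_mem_redWord {w₀ : Function.End (I → ℤ)} {ν : ℕ} (hw : IsLongest A w₀ ν)
    {p : (Fin ν → I) × (Fin ν → K)} (hp : p.1 ∈ RedWord A w₀ ν) :
    IsReduced A (letters (toLWord p)) := by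
  intro l hl
  rw [List.length_map, length_toLWord, ← hw.len_eq]
  exact Nat.sInf_le ⟨l, rfl, hl.trans ((mem_redWord_iff p).1 hp)⟩

lemma Move.append (u : LWord I K) {L L' : LWord I K} (h : Move A L L') :
    Move A (u ++ L) (u ++ L') := by
  induction u with
  | nil => exact h
  | cons x u ih => exact .cons x ih

lemma Move.exists_append {L L' : LWord I K} (h : Move A L L') :
    ∃ u M M', L = u ++ M ∧ L' = u ++ M' ∧ HeadMove A M M' := by
  induction h with
  | head h => exact ⟨[], _, _, rfl, rfl, h⟩
  | cons x _ ih =>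
    obtain ⟨u, M, M', rfl, rfl, h⟩ := ih
    exact ⟨x :: u, M, M', rfl, rfl, h⟩

lemma Move.of_take_drop {L L' : LWord I K} (l m : ℕ)
    (h : ∀ k, k < l ∨ m ≤ k → L[k]? = L'[k]?)
    (hm : L.drop m = L'.drop m → HeadMove A (L.drop l) (L'.drop l)) : Move A L L' := by
  have h1 : L.take l = L'.take l := by
    ext1 k
    rw [List.getElem?_take, List.getElem?_take]
    split_ifs with hk
    · exact h k (.inl hk)
    · rfl
  have h2 : L.drop m = L'.drop m := by
    ext1 k
    rw [List.getElem?_drop, List.getElem?_drop]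
    exact h _ (.inr (Nat.le_add_right _ _))
  rw [← List.take_append_drop l L, ← List.take_append_drop l L', ← h1]
  exact Move.append _ (.head (hm h2))

lemma Adjacent.move {w₀ : Function.End (I → ℤ)} {ν : ℕ} {p q : (Fin ν → I) × (Fin ν → K)}
    (h : Adjacent A w₀ ν p q) : Move A (toLWord p) (toLWord q) := by
  obtain ⟨-, -, ⟨l, h0, h1, h2, hA, e1, e2, e3, e4, hk, e5, e6, e7⟩ |
    ⟨l, h0, h1, hA, e1, e2, hk, e3, e4⟩⟩ := h
  · refine .of_take_drop l (l + 3) (fun k hkl => ?_) (fun hd => ?_)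
    · rcases lt_or_ge k ν with hkν | hkν
      · obtain ⟨f1, f2⟩ := hk ⟨k, hkν⟩ (by simp; omega) (by simp; omega) (by simp; omega)
        rw [getElem?_toLWord _ hkν, getElem?_toLWord _ hkν, f1, f2]
      · rw [List.getElem?_eq_none (by simpa), List.getElem?_eq_none (by simpa)]
    · rw [List.drop_eq_getElem_cons (by simpa using h0),
        List.drop_eq_getElem_cons (by simpa using h1),
        List.drop_eq_getElem_cons (by simpa using h2),
        List.drop_eq_getElem_cons (l := toLWord q) (by simpa using h0),
        List.drop_eq_getElem_cons (l := toLWord q) (by simpa using h1),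
        List.drop_eq_getElem_cons (l := toLWord q) (by simpa using h2)]
      simp only [getElem_toLWord, add_assoc, Nat.reduceAdd, e1, e2, e3, e4, e5, e6, e7, hd]
      exact .braid _ _ _ _ _ _ hA
  · refine .of_take_drop l (l + 2) (fun k hkl => ?_) (fun hd => ?_)
    · rcases lt_or_ge k ν with hkν | hkν
      · obtain ⟨f1, f2⟩ := hk ⟨k, hkν⟩ (by simp; omega) (by simp; omega)
        rw [getElem?_toLWord _ hkν, getElem?_toLWord _ hkν, f1, f2]
      · rw [List.getElem?_eq_none (by simpa), List.getElem?_eq_none (by simpa)]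
    · rw [List.drop_eq_getElem_cons (by simpa using h0),
        List.drop_eq_getElem_cons (by simpa using h1),
        List.drop_eq_getElem_cons (l := toLWord q) (by simpa using h0),
        List.drop_eq_getElem_cons (l := toLWord q) (by simpa using h1)]
      simp only [getElem_toLWord, add_assoc, Nat.reduceAdd, e1, e2, e3, e4, hd]
      exact .comm _ _ _ _ _ hA

lemma Move.adjacent {w₀ : Function.End (I → ℤ)} {ν : ℕ} {p q : (Fin ν → I) × (Fin ν → K)}
    (h : Move A (toLWord p) (toLWord q)) (hp : p.1 ∈ RedWord A w₀ ν)
    (hq : q.1 ∈ RedWord A w₀ ν) : Adjacent A w₀ ν p q := by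
  obtain ⟨u, M, M', hM, hM', h⟩ := h.exists_append
  have hν := congrArg List.length hM
  rw [length_toLWord, List.length_append] at hν
  have hpk : ∀ {k : ℕ} {x : I × K} (hk : k < ν), (u ++ M)[k]? = some x →
      p.1 ⟨k, hk⟩ = x.1 ∧ p.2 ⟨k, hk⟩ = x.2 := by
    intro k x hk hx
    rw [← hM, getElem?_toLWord p hk, Option.some_inj] at hx
    simp [← hx]
  have hqk : ∀ {k : ℕ} {x : I × K} (hk : k < ν), (u ++ M')[k]? = some x →
      q.1 ⟨k, hk⟩ = x.1 ∧ q.2 ⟨k, hk⟩ = x.2 := by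
    intro k x hk hx
    rw [← hM', getElem?_toLWord q hk, Option.some_inj] at hx
    simp [← hx]
  have hpqk : ∀ k : Fin ν, (u ++ M')[(k : ℕ)]? = (u ++ M)[(k : ℕ)]? →
      q.1 k = p.1 k ∧ q.2 k = p.2 k := by
    intro k hk
    rw [← hM, ← hM', getElem?_toLWord q k.2, getElem?_toLWord p k.2] at hk
    simpa using hk
  refine ⟨hp, hq, ?_⟩
  cases h with
  | braid i j a b c t hij =>
    simp only [List.length_cons] at hν
    refine .inl ⟨u.length, by omega, by omega, by omega, ?_⟩
    obtain ⟨p1, p2⟩ := hpk (k := u.length) (x := (i, a)) (by omega) (by simp)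
    obtain ⟨p3, p4⟩ := hpk (k := u.length + 1) (x := (j, b)) (by omega) (by simp)
    obtain ⟨p5, p6⟩ := hpk (k := u.length + 2) (x := (i, c)) (by omega) (by simp)
    obtain ⟨q1, q2⟩ := hqk (k := u.length) (by omega) (by simp; rfl)
    obtain ⟨q3, q4⟩ := hqk (k := u.length + 1) (by omega) (by simp; rfl)
    obtain ⟨q5, q6⟩ := hqk (k := u.length + 2) (by omega) (by simp; rfl)
    rw [p1, p2, p3, p4, p5, p6, q1, q2, q3, q4, q5, q6]
    refine ⟨hij, rfl, rfl, rfl, rfl, fun k h0 h1 h2 => hpqk k ?_, rfl, rfl, rfl⟩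
    rcases lt_or_ge (k : ℕ) u.length with hk | hk
    · rw [List.getElem?_append_left hk, List.getElem?_append_left hk]
    · obtain ⟨m, hm⟩ : ∃ m, (k : ℕ) = u.length + (m + 3) := ⟨k - u.length - 3, by omega⟩
      rw [List.getElem?_append_right hk, List.getElem?_append_right hk, hm,
        Nat.add_sub_cancel_left]
      rfl
  | comm i j a b t hij =>
    simp only [List.length_cons] at hν
    refine .inr ⟨u.length, by omega, by omega, ?_⟩
    obtain ⟨p1, p2⟩ := hpk (k := u.length) (x := (i, a)) (by omega) (by simp)
    obtain ⟨p3, p4⟩ := hpk (k := u.length + 1) (x := (j, b)) (by omega) (by simp)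
    obtain ⟨q1, q2⟩ := hqk (k := u.length) (by omega) (by simp; rfl)
    obtain ⟨q3, q4⟩ := hqk (k := u.length + 1) (by omega) (by simp; rfl)
    rw [p1, p2, p3, p4, q1, q2, q3, q4]
    refine ⟨hij, rfl, rfl, fun k h0 h1 => hpqk k ?_, rfl, rfl⟩
    rcases lt_or_ge (k : ℕ) u.length with hk | hk
    · rw [List.getElem?_append_left hk, List.getElem?_append_left hk]
    · obtain ⟨m, hm⟩ : ∃ m, (k : ℕ) = u.length + (m + 2) := ⟨k - u.length - 2, by omega⟩
      rw [List.getElem?_append_right hk, List.getElem?_append_right hk, hm,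
        Nat.add_sub_cancel_left]
      rfl

lemma MoveEqv.of_adjacent {w₀ : Function.End (I → ℤ)} {ν : ℕ}
    {p q : (Fin ν → I) × (Fin ν → K)} (h : Relation.EqvGen (Adjacent A w₀ ν) p q) :
    p = q ∨ p.1 ∈ RedWord A w₀ ν ∧ q.1 ∈ RedWord A w₀ ν ∧
      MoveEqv A (toLWord p) (toLWord q) := by
  induction h with
  | rel p q h => exact .inr ⟨h.1, h.2.1, .rel _ _ h.move⟩
  | refl p => exact .inl rfl
  | symm p q _ ih => exact ih.imp .symm fun h => ⟨h.2.1, h.1, h.2.2.symm⟩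
  | trans p q r _ _ ih ih' =>
    rcases ih with rfl | h
    · exact ih'
    · rcases ih' with rfl | h'
      · exact .inr h
      · exact .inr ⟨h.1, h'.2.1, h.2.2.trans h'.2.2⟩

lemma MoveEqv.adjacent (hA : IsSimplyLacedCartan A) {w₀ : Function.End (I → ℤ)} {ν : ℕ}
    {L L' : LWord I K} (h : MoveEqv A L L') :
    ∀ p q : (Fin ν → I) × (Fin ν → K), toLWord p = L → toLWord q = L' →
      p.1 ∈ RedWord A w₀ ν → Relation.EqvGen (Adjacent A w₀ ν) p q := by
  have mem : ∀ {p q : (Fin ν → I) × (Fin ν → K)}, MoveEqv A (toLWord p) (toLWord q) →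
      p.1 ∈ RedWord A w₀ ν → q.1 ∈ RedWord A w₀ ν := by
    intro p q h hp
    rw [mem_redWord_iff] at hp ⊢
    exact (h.wordProd_eq hA).symm.trans hp
  induction h with
  | rel L L' h =>
    rintro p q rfl rfl hp
    exact .rel _ _ (h.adjacent hp (mem (.rel _ _ h) hp))
  | refl L =>
    rintro p q rfl hq -
    rw [toLWord_injective hq]
    exact .refl _
  | symm L L' h ih =>
    rintro p q rfl rfl hp
    exact .symm _ _ (ih q p rfl rfl (mem (MoveEqv.symm h) hp))
  | trans L L' L'' h _ ih ih' =>
    rintro p q rfl rfl hp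
    obtain ⟨r, rfl⟩ := exists_toLWord_eq L' ((MoveEqv.length_eq h).symm.trans (length_toLWord p))
    exact .trans _ r _ (ih p r rfl rfl hp) (ih' r q rfl rfl (mem h hp))

lemma toLWord_succ {n : ℕ} (p : (Fin (n + 1) → I) × (Fin (n + 1) → K)) :
    toLWord p = (p.1 0, p.2 0) :: List.ofFn fun k : Fin n => (p.1 k.succ, p.2 k.succ) := by
  rw [toLWord, List.ofFn_succ]

lemma toLWord_rescale {n : ℕ} (f : Fin (n + 1) → I) (a : Fin (n + 1) → K) (c : K) :
    toLWord (f, fun k => if (k : ℕ) = 0 then c * a k else a k) =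
      (f 0, c * a 0) :: List.ofFn fun k : Fin n => (f k.succ, a k.succ) := by
  simp [toLWord, List.ofFn_succ]

end Words

/-- rescaling the first parameter by `c` is compatible with `∼`
(on representatives whose first letter is `i`); hence `T_{i,c} : 𝒰_K → 𝒰_K`
is well defined. -/
theorem T_well_defined (A : Matrix I I ℤ) (hA : IsSimplyLacedCartan A)
    (w₀ : Function.End (I → ℤ)) (ν : ℕ) (hw : IsLongest A w₀ ν)
    {K : Type*} [CommGroup K] [AddCommSemigroup K]
    (hdist : ∀ a b c : K, a * (b + c) = a * b + a * c)
    (i : I) (c : K) (p q : (Fin ν → I) × (Fin ν → K))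
    (hpq : Relation.EqvGen (Adjacent A w₀ ν) p q)
    (hp : ∀ k : Fin ν, (k : ℕ) = 0 → p.1 k = i)
    (hq : ∀ k : Fin ν, (k : ℕ) = 0 → q.1 k = i) :
    Relation.EqvGen (Adjacent A w₀ ν)
      (p.1, fun k => if (k : ℕ) = 0 then c * p.2 k else p.2 k)
      (q.1, fun k => if (k : ℕ) = 0 then c * q.2 k else q.2 k) := by
  rcases MoveEqv.of_adjacent hpq with rfl | ⟨hp', -, h⟩
  · exact .refl _
  cases ν with
  | zero => exact Subsingleton.elim p q ▸ .refl _
  | succ n =>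
    have hred := isReduced_of_mem_redWord hw hp'
    rw [toLWord_succ, hp 0 rfl] at hred h
    rw [toLWord_succ, hq 0 rfl] at h
    refine (h.rescale hA hdist hred c).adjacent hA _ _ ?_ ?_ hp'
    · rw [toLWord_rescale, hp 0 rfl]
    · rw [toLWord_rescale, hq 0 rfl]

end Lusztig
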